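/- arXiv:2511.15410 — 2 statements merged into one kernel-verified Lean document; each statement's English description precedes it below -/
import Mathlib

section
/- Every unitary operator U on a complex Hilbert space H has a strict square root: a unitary operator V on H such that V² = U and such that, for every orthogonal projection p on H, p commutes with U if and only if p commutes with V. -/
open ContinuousLinearMap in
/-- The orthogonal projection onto the kernel of a self-adjoint operator commutes with every
self-adjoint operator commuting with that operator. -/
theorem commute_starProjection_ker {H : Type*}
    [NormedAddCommGroup H] [InnerProductSpace ℂ H] [CompleteSpace H]
    {N T : H →L[ℂ] H} (hT : IsSelfAdjoint T) (h : Commute T N) :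
    Commute T N.ker.starProjection := by
  have key : N.ker.starProjection * T * N.ker.starProjection = T * N.ker.starProjection := by
    ext x
    refine Submodule.starProjection_eq_self_iff.2 ?_
    have hx : N (N.ker.starProjection x) = 0 :=
      LinearMap.mem_ker.1 (Submodule.starProjection_apply_mem N.ker x)
    have hc := congrArg (fun f : H →L[ℂ] H => f (N.ker.starProjection x)) h.eq
    refine LinearMap.mem_ker.2 (hc.symm.trans ?_)
    change T (N (N.ker.starProjection x)) = 0
    rw [hx, map_zero]
  have hP : star N.ker.starProjection = N.ker.starProjection :=
    isSelfAdjoint_starProjection N.ker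
  have key' := congrArg star key
  simp only [star_mul, hP, hT.star_eq, ← mul_assoc] at key'
  exact key.symm.trans key'

open ContinuousLinearMap in
/-- A self-adjoint operator `D` satisfies `D = J|D|` for a self-adjoint unitary `J` commuting with
all self-adjoint operators that commute with `D`. -/
theorem exists_symmetry_mul_abs {H : Type*}
    [NormedAddCommGroup H] [InnerProductSpace ℂ H] [CompleteSpace H]
    {D : H →L[ℂ] H} (hD : IsSelfAdjoint D) :
    ∃ J : H →L[ℂ] H, IsSelfAdjoint J ∧ J * J = 1 ∧ J * CFC.abs D = D ∧
      ∀ T : H →L[ℂ] H, IsSelfAdjoint T → Commute T D → Commute T J := by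
  set N := CFC.abs D - D with hN
  set P := N.ker.starProjection with hPdef
  have hP : star P = P := isSelfAdjoint_starProjection N.ker
  have hPP : P * P = P := Submodule.isIdempotentElem_starProjection N.ker
  have hA : IsSelfAdjoint (CFC.abs D) := (CFC.abs_nonneg D).isSelfAdjoint
  have hcomm : CFC.abs D * D = D * CFC.abs D := CFC.commute_abs_self D
  have hNP : N * P = 0 := by
    ext x
    exact LinearMap.mem_ker.1 (Submodule.starProjection_apply_mem N.ker x)
  have hPN : P * N = 0 := by
    have := congrArg star hNP
    simpa [hP, (hA.sub hD).star_eq, hN] using this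
  have hsq : N * (CFC.abs D + D) = 0 := by
    have := CFC.abs_mul_abs D
    rw [hD.star_eq] at this
    simp only [hN, sub_mul, mul_add, this, hcomm]
    abel
  have hPadd : P * (CFC.abs D + D) = CFC.abs D + D := by
    ext x
    refine Submodule.starProjection_eq_self_iff.2 (LinearMap.mem_ker.2 ?_)
    exact congrArg (fun f : H →L[ℂ] H => f x) hsq
  refine ⟨2 * P - 1, ?_, ?_, ?_, fun T hT hTD => ?_⟩
  · simp [isSelfAdjoint_iff, two_mul, hP]
  · have : (2 * P - 1) * (2 * P - 1) = 4 * (P * P) - 4 * P + 1 := by noncomm_ring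
    rw [this, hPP]; simp
  · have : (2 * P - 1) * CFC.abs D = P * N + P * (CFC.abs D + D) - CFC.abs D := by
      rw [hN]; noncomm_ring
    rw [this, hPN, hPadd]; abel
  · have hTA : Commute T (CFC.abs D) := 
      hTD.symm.cfcAbs_right (by rw [hT.star_eq]; exact hTD.symm)
    have := commute_starProjection_ker hT (hTA.sub_right hTD)
    exact ((Commute.ofNat_right T 2).mul_right this).sub_right (Commute.one_right T)

/-- Every unitary operator `U` on a complex Hilbert space has a strict square root:
a unitary `V` with `V² = U` commuting with exactly the same orthogonal projections
as `U`. -/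
theorem stmt_6 {H : Type*}
    [NormedAddCommGroup H] [InnerProductSpace ℂ H] [CompleteSpace H]
    (U : H →L[ℂ] H) (hU : U ∈ unitary (H →L[ℂ] H)) :
    ∃ V : H →L[ℂ] H, V ∈ unitary (H →L[ℂ] H) ∧ V * V = U ∧
      ∀ p : H →L[ℂ] H, IsSelfAdjoint p → IsIdempotentElem p →
        (p * U = U * p ↔ p * V = V * p) := by
  have h1 : star U * U = 1 := Unitary.star_mul_self_of_mem hU
  have h2 : U * star U = 1 := Unitary.mul_star_self_of_mem hU
  have hUU : Commute U (star U) := h2.trans h1.symm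
  set D : H →L[ℂ] H := Complex.I • (star U - U) with hDdef
  have hD : IsSelfAdjoint D := by
    rw [isSelfAdjoint_iff, hDdef, star_smul, star_sub, star_star, Complex.star_def, Complex.conj_I,
      neg_smul, ← smul_neg, neg_sub]
  obtain ⟨J, hJ, hJJ, hJD, hJc⟩ := exists_symmetry_mul_abs hD
  set C := CFC.abs (1 + U) with hC
  set S := CFC.abs (1 - U) with hS
  have hCs : IsSelfAdjoint C := (CFC.abs_nonneg _).isSelfAdjoint
  have hSs : IsSelfAdjoint S := (CFC.abs_nonneg _).isSelfAdjoint
  have hCC : C * C = 2 + U + star U := by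
    rw [hC, CFC.abs_mul_abs, star_add, star_one, add_mul, mul_add, mul_add, h1,
      ← one_add_one_eq_two]
    simp only [one_mul, mul_one]; abel
  have hSS : S * S = 2 - U - star U := by
    rw [hS, CFC.abs_mul_abs, star_sub, star_one, sub_mul, mul_sub, mul_sub, h1,
      ← one_add_one_eq_two]
    simp only [one_mul, mul_one]; abel
  have commC {T : H →L[ℂ] H} (a : Commute T U) (b : Commute T (star U)) : Commute T C :=
    ((Commute.one_right T).add_right a).symm.cfcAbs_right
      (by simpa using ((Commute.one_right T).add_right b).star_star.symm)
  have commS {T : H →L[ℂ] H} (a : Commute T U) (b : Commute T (star U)) : Commute T S :=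
    ((Commute.one_right T).sub_right a).symm.cfcAbs_right
      (by simpa using ((Commute.one_right T).sub_right b).star_star.symm)
  have commD {T : H →L[ℂ] H} (a : Commute T U) (b : Commute T (star U)) : Commute T D :=
    (b.sub_right a).smul_right _
  have hUC : Commute U C := commC (Commute.refl U) hUU
  have hUC' : Commute (star U) C := commC hUU.symm (Commute.refl _)
  have hUS : Commute U S := commS (Commute.refl U) hUU
  have hUS' : Commute (star U) S := commS hUU.symm (Commute.refl _)
  have hCS : C * S = S * C := (commS hUC.symm hUC'.symm).eq
  have hCJ : C * J = J * C := (hJc C hCs (commD hUC.symm hUC'.symm)).eq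
  have hSJ : S * J = J * S := (hJc S hSs (commD hUS.symm hUS'.symm)).eq
  have hCSD : C * S = CFC.abs D := by
    refine (CFC.sqrt_unique ?_ (Commute.mul_nonneg (CFC.abs_nonneg _) (CFC.abs_nonneg _) hCS)).symm
    have e1 : C * S * (C * S) = (C * C) * (S * S) := by
      rw [mul_assoc, ← mul_assoc S, ← hCS]; simp only [mul_assoc]
    rw [e1, hCC, hSS, hD.star_eq, hDdef, smul_mul_smul_comm, Complex.I_mul_I, neg_smul, one_smul]
    have e2 : (2 + U + star U) * (2 - U - star U) + (star U - U) * (star U - U)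
        = 4 - 2 * (U * star U) - 2 * (star U * U) := by
      rw [show (4 : H →L[ℂ] H) = 2 * 2 by norm_num]; noncomm_ring
    rw [h1, h2] at e2
    rw [eq_neg_iff_add_eq_zero, e2]; norm_num
  set K := J * S with hK
  have hKs : star K = K := by rw [hK, star_mul, hJ.star_eq, hSs.star_eq, hSJ]
  have hKK : K * K = 2 - U - star U := by
    rw [hK, mul_assoc, ← mul_assoc S, hSJ, mul_assoc, ← mul_assoc, hJJ, one_mul, hSS]
  have hCK : C * K = D := by rw [hK, ← mul_assoc, hCJ, mul_assoc, hCSD, hJD]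
  have hKC : K * C = D := by rw [hK, mul_assoc, ← hCS, hCSD, hJD]
  have hID : Complex.I • D = U - star U := by
    rw [hDdef, smul_smul, Complex.I_mul_I, neg_smul, one_smul, neg_sub]
  set V : H →L[ℂ] H := (2⁻¹ : ℂ) • (C + Complex.I • K) with hV
  have hVs : star V = (2⁻¹ : ℂ) • (C - Complex.I • K) := by
    simp [hV, star_smul, hKs, hCs.star_eq, sub_eq_add_neg]
  have htwo : (2 : H →L[ℂ] H) = (2 : ℂ) • 1 := by rw [ofNat_smul_eq_nsmul]; simp
  have hVV : V * V = U := by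
    simp only [hV, add_mul, mul_add, smul_mul_assoc, mul_smul_comm, smul_smul,
      hCC, hKK, hCK, hKC, hID]
    rw [htwo]; match_scalars <;> ring_nf <;> norm_num [Complex.I_sq]
  refine ⟨V, Unitary.mem_iff.2 ⟨?_, ?_⟩, hVV, fun p hp _ => ⟨fun h => ?_, fun h => ?_⟩⟩
  · rw [hVs]
    simp only [hV, sub_mul, mul_add, smul_mul_assoc, mul_smul_comm, smul_smul,
      hCC, hKK, hCK, hKC, hID]
    rw [htwo]; match_scalars <;> ring_nf <;> norm_num [Complex.I_sq]
  · rw [hVs]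
    simp only [hV, add_mul, mul_sub, smul_mul_assoc, mul_smul_comm, smul_smul,
      hCC, hKK, hCK, hKC, hID]
    rw [htwo]; match_scalars <;> ring_nf <;> norm_num [Complex.I_sq]
  · have h' : Commute p (star U) := by
      have := congrArg star h
      rw [star_mul, star_mul, hp.star_eq] at this
      exact this.symm
    have hpJ : Commute p J := hJc p hp (commD h h')
    exact (((commC h h').add_right ((hpJ.mul_right (commS h h')).smul_right _)).smul_right _).eq
  · rw [← hVV, ← mul_assoc, h, mul_assoc, h, mul_assoc]
end

section
/- Let H be a complex Hilbert space of dimension at least 2. Then the subring of bounded operators on H generated by the orthogonal projections is the entire ring of bounded operators; i.e., every bounded operator on H is a finite sum of finite products of orthogonal projections. -/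
/-- In a C⋆-algebra, every self-adjoint `b` of norm at most `1 / 2` anticommuting with a symmetry
`u` is the part of some symmetry: `2 * b + u * c` is a symmetry for some `c` commuting with `u`. -/
lemma exists_symmetry_of_anticommute {A : Type*} [CStarAlgebra A] {u b : A}
    (hu : IsSelfAdjoint u) (hu2 : u * u = 1) (hb : IsSelfAdjoint b) (hub : u * b = -(b * u))
    (hnorm : ‖b‖ ≤ 1 / 2) :
    ∃ c : A, Commute c u ∧ IsSelfAdjoint (2 * b + u * c) ∧
      (2 * b + u * c) * (2 * b + u * c) = 1 := by
  have hbb : IsSelfAdjoint (b * b) := by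
    simpa [hb.star_eq] using IsSelfAdjoint.star_mul_self b
  have hle : ∀ t ∈ spectrum ℝ (b * b), 0 ≤ 1 - 4 * t := by
    intro t ht
    have : ‖t‖ ≤ ‖b * b‖ := by
      rcases subsingleton_or_nontrivial A with _ | _
      · simp at ht
      · exact spectrum.norm_le_norm_of_mem ht
    have h2 : ‖b * b‖ ≤ 1 / 2 * (1 / 2) := (norm_mul_le b b).trans (by gcongr)
    have h3 := le_abs_self t
    rw [Real.norm_eq_abs] at this
    linarith
  set c : A := cfc (fun t : ℝ => √(1 - 4 * t)) (b * b) with hc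
  have hcs : IsSelfAdjoint c := cfc_predicate _ _
  have hcu : Commute c u := by
    refine Commute.cfc_real ?_ _
    change b * b * u = u * (b * b)
    rw [← mul_assoc, hub, neg_mul, mul_assoc b u b, hub, mul_neg, neg_neg, mul_assoc]
  have hcb : Commute c b := Commute.cfc_real (mul_assoc b b b) _
  have hcc : c * c = 1 - 4 * (b * b) := by
    rw [hc, ← cfc_mul _ _ _ (by fun_prop) (by fun_prop)]
    rw [cfc_congr (g := fun t : ℝ => 1 - 4 * t)
      fun t ht => Real.mul_self_sqrt (hle t ht)]
    rw [cfc_sub .., cfc_const_one .., cfc_const_mul .., cfc_id' ..]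
    rw [Algebra.smul_def, map_ofNat]
  refine ⟨c, hcu, ?_, ?_⟩
  · rw [IsSelfAdjoint, star_add, star_mul, star_mul, hcs.star_eq, hu.star_eq, hb.star_eq,
      hcu.eq, star_ofNat]
    congr 1
    noncomm_ring
  · have h1 : u * c * (u * c) = c * c := by
      rw [mul_assoc, ← mul_assoc c, hcu.eq, ← mul_assoc, ← mul_assoc, hu2, one_mul]
    have h2 : b * (u * c) + u * c * b = 0 := by
      rw [mul_assoc, hcb.eq, ← mul_assoc, ← mul_assoc, hub]
      simp
    calc (2 * b + u * c) * (2 * b + u * c)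
        = 4 * (b * b) + 2 * (b * (u * c) + u * c * b) + u * c * (u * c) := by noncomm_ring
      _ = 1 := by rw [h1, h2, hcc]; simp

/-- In a C⋆-algebra, the off-diagonal corners with respect to any projection lie in the subring
generated by the projections. -/
lemma one_sub_mul_mul_mem_closure {A : Type*} [CStarAlgebra A] {p : A}
    (hp : IsSelfAdjoint p) (hp2 : IsIdempotentElem p) (x : A) :
    (1 - p) * x * p ∈ Subring.closure {p : A | IsSelfAdjoint p ∧ IsIdempotentElem p} := by
  have hpp : p * p = p := hp2
  obtain ⟨n, hn⟩ := exists_nat_ge (4 * ‖(1 - p) * x * p‖ + 1)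
  have hn0 : (0 : ℝ) < n := by linarith [norm_nonneg ((1 - p) * x * p)]
  set s : A := (n : ℝ)⁻¹ • ((1 - p) * x * p) with hs
  have hns : ‖s‖ ≤ 1 / 4 := by
    rw [hs, norm_smul, norm_inv, Real.norm_natCast, inv_mul_le_iff₀ hn0]
    linarith
  have hxs : (1 - p) * x * p = n • s := by
    rw [hs, ← Nat.cast_smul_eq_nsmul ℝ, smul_smul, mul_inv_cancel₀ hn0.ne', one_smul]
  have hsp : s * p = s := by simp [hs, mul_assoc, hpp]
  have hps : p * s = 0 := by simp [hs, ← mul_assoc, mul_sub, hpp]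
  have hsp' : p * star s = star s := by simpa [hp.star_eq] using congr(star $hsp)
  have hps' : star s * p = 0 := by simpa [hp.star_eq] using congr(star $hps)
  obtain ⟨c, hcu, hw, hww⟩ := exists_symmetry_of_anticommute (u := 2 * p - 1) (b := s + star s)
    (by simp [IsSelfAdjoint, hp.star_eq, two_mul])
    (by
      have : (2 * p - 1) * (2 * p - 1) = 4 * (p * p) - 4 * p + 1 := by noncomm_ring
      simp [this, hpp])
    (by simp [IsSelfAdjoint, add_comm])
    (by
      simp only [sub_mul, mul_add, mul_sub, add_mul, two_mul, hsp, hps, hsp', hps', one_mul,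
        mul_one]
      abel)
    (by
      refine (norm_add_le _ _).trans ?_
      rw [norm_star]
      linarith)
  set w := 2 * (s + star s) + (2 * p - 1) * c with hw_def
  set q : A := (2 : ℝ)⁻¹ • (1 + w) with hq
  have hqmem : q ∈ Subring.closure {p : A | IsSelfAdjoint p ∧ IsIdempotentElem p} := by
    refine Subring.subset_closure ⟨?_, ?_⟩
    · rw [IsSelfAdjoint, hq, star_smul, star_add, hw.star_eq]; simp
    · rw [IsIdempotentElem, hq, smul_mul_smul_comm]
      have : (1 + w) * (1 + w) = (2 : ℝ) • (1 + w) := by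
        rw [two_smul]
        calc (1 + w) * (1 + w) = 1 + w + w + w * w := by noncomm_ring
          _ = _ := by rw [hww]; abel
      rw [this, smul_smul]
      norm_num
  have hpmem : p ∈ Subring.closure {p : A | IsSelfAdjoint p ∧ IsIdempotentElem p} :=
    Subring.subset_closure ⟨hp, hp2⟩
  have hcp : (2 * p - 1) * c * p = p * c * p := by
    have h1 : c * (2 * p - 1) * p = (2 * p - 1) * c * p := by rw [hcu.eq]
    have h2 : c * (2 * p - 1) * p = c * p := by
      simp only [two_mul, mul_sub, mul_add, sub_mul, add_mul, mul_assoc, hpp, mul_one]; abel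
    have h3 : (2 * p - 1) * c * p = 2 * (p * c * p) - c * p := by noncomm_ring
    have h4 : (2 : ℝ) • (c * p) = (2 : ℝ) • (p * c * p) := by
      rw [← h1, h2] at h3
      rw [two_smul, two_smul, ← two_mul (p * c * p)]
      nth_rw 1 [h3]
      abel
    rw [← h1, h2]
    exact smul_right_injective A (two_ne_zero (α := ℝ)) h4
  have hcorner : (1 - p) * q * p = s := by
    have h1 : (1 - p) * (1 + w) * p = (2 : ℝ) • s := by
      have h2 : (1 + w) * p = p + (s + s) + p * c * p := by
        rw [add_mul, hw_def, add_mul, hcp, mul_assoc, add_mul, hsp, hps', one_mul, add_zero,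
          two_mul, ← add_assoc p]
      rw [mul_assoc, h2, two_smul, sub_mul, one_mul, mul_add, mul_add, mul_add, hps, hpp,
        ← mul_assoc, ← mul_assoc, hpp]
      abel
    rw [hq, mul_smul_comm, smul_mul_assoc, h1, smul_smul]
    norm_num
  rw [hxs, ← hcorner]
  exact nsmul_mem (mul_mem (mul_mem (sub_mem (one_mem _) hpmem) hqmem) hpmem) n

/-- The subring generated by the projections of a C⋆-algebra is a Lie ideal. -/
lemma commutator_mem_closure_projections {A : Type*} [CStarAlgebra A] {r : A}
    (hr : r ∈ Subring.closure {p : A | IsSelfAdjoint p ∧ IsIdempotentElem p}) (x : A) :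
    r * x - x * r ∈ Subring.closure {p : A | IsSelfAdjoint p ∧ IsIdempotentElem p} := by
  induction hr using Subring.closure_induction with
  | mem p hp =>
    have h1 := one_sub_mul_mul_mem_closure hp.1 hp.2 x
    have h2 := one_sub_mul_mul_mem_closure
      (show IsSelfAdjoint (1 - p) from (IsSelfAdjoint.one A).sub hp.1) hp.2.one_sub x
    convert sub_mem h2 h1 using 1
    noncomm_ring
  | zero => simp
  | one => simp
  | add r s _ _ hr hs => convert add_mem hr hs using 1; noncomm_ring
  | neg r _ hr => convert neg_mem hr using 1; noncomm_ring
  | mul r s hr' hs' hr hs =>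
    convert add_mem (mul_mem hr' hs) (mul_mem hr hs') using 1
    noncomm_ring

/-- If a subring `R` is a Lie ideal, then it contains the two-sided ideal generated by the
commutators of its elements. -/
lemma Subring.mul_commutator_mul_mem {A : Type*} [Ring A] {R : Subring A}
    (hR : ∀ r ∈ R, ∀ x, r * x - x * r ∈ R) {r s : A} (hr : r ∈ R) (hs : s ∈ R) (x y : A) :
    x * (r * s - s * r) * y ∈ R := by
  have h (z : A) : (r * s - s * r) * z ∈ R := by
    convert sub_mem (hR r hr (s * z)) (mul_mem hs (hR r hr z)) using 1
    noncomm_ring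
  convert sub_mem (h (y * x)) (hR _ (h y) x) using 1
  noncomm_ring

/-- The subring generated by the projections contains the two-sided ideal generated by any
off-diagonal corner. -/
lemma mul_mul_mem_closure_projections {A : Type*} [CStarAlgebra A] {p v : A}
    (hp : IsSelfAdjoint p) (hp2 : IsIdempotentElem p) (hvp : v * p = v) (hpv : p * v = 0)
    (x y : A) :
    x * v * y ∈ Subring.closure {p : A | IsSelfAdjoint p ∧ IsIdempotentElem p} := by
  have hv : v ∈ Subring.closure {p : A | IsSelfAdjoint p ∧ IsIdempotentElem p} := by
    simpa [sub_mul, hpv, hvp] using one_sub_mul_mul_mem_closure hp hp2 v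
  simpa [hpv, hvp] using Subring.mul_commutator_mul_mem
    (fun r hr x => commutator_mem_closure_projections hr x) hv
    (Subring.subset_closure ⟨hp, hp2⟩) x y

/-- A C⋆-algebra containing two isometries with orthogonal ranges is generated, as a ring, by its
projections. -/
lemma closure_projections_eq_top_of_isometries {A : Type*} [CStarAlgebra A] {s t : A}
    (hs : star s * s = 1) (ht : star t * t = 1) (hst : star s * t = 0) :
    Subring.closure {p : A | IsSelfAdjoint p ∧ IsIdempotentElem p} = ⊤ := by
  refine (Subring.eq_top_iff' _).2 fun x => ?_
  have h := mul_mul_mem_closure_projections (p := s * star s) (v := t * star s)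
    (IsSelfAdjoint.mul_star_self s)
    (by rw [IsIdempotentElem, mul_assoc, ← mul_assoc (star s), hs, one_mul])
    (by rw [mul_assoc, ← mul_assoc (star s), hs, one_mul])
    (by rw [mul_assoc, ← mul_assoc (star s), hst, zero_mul, mul_zero]) (star t) (s * x)
  rwa [← mul_assoc (star t), ht, one_mul, ← mul_assoc, hs, one_mul] at h

section

variable {H : Type*} [NormedAddCommGroup H] [InnerProductSpace ℂ H] [CompleteSpace H]

open InnerProductSpace in
lemma OrthonormalBasis.closure_projections_eq_top {ι : Type*} [Fintype ι] [Nontrivial ι]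
    (b : OrthonormalBasis ι ℂ H) :
    Subring.closure {p : H →L[ℂ] H | IsSelfAdjoint p ∧ IsIdempotentElem p} = ⊤ := by
  refine (Subring.eq_top_iff' _).2 fun x => ?_
  have hx : x = ∑ i, rankOne ℂ (b i) (b i) * x := by
    rw [← Finset.sum_mul, b.sum_rankOne_eq_id]
    rfl
  rw [hx]
  refine sum_mem fun i _ => ?_
  obtain ⟨j, hj⟩ := exists_ne i
  have hp : IsStarProjection (rankOne ℂ (b i) (b i)) :=
    isStarProjection_rankOne_self (b.orthonormal.1 i)
  have hcomp (i j k : ι) : rankOne ℂ (b i) (b j) * rankOne ℂ (b j) (b k) =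
      rankOne ℂ (b i) (b k) := by
    ext z; simp [b.orthonormal.1 j]
  have h := mul_mul_mem_closure_projections (v := rankOne ℂ (b j) (b i)) hp.isSelfAdjoint
    hp.isIdempotentElem (hcomp j i i)
    (by ext z; simp [b.orthonormal.2 hj.symm])
    (rankOne ℂ (b i) (b j)) x
  rwa [hcomp] at h

lemma HilbertBasis.closure_projections_eq_top {ι : Type*} [Infinite ι]
    (b : HilbertBasis ι ℂ H) :
    Subring.closure {p : H →L[ℂ] H | IsSelfAdjoint p ∧ IsIdempotentElem p} = ⊤ := by
  classical
  obtain ⟨e⟩ : Nonempty (ι ⊕ ι ≃ ι) := Cardinal.eq.1 (by simp)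
  let V (f : ι → ι) (hf : f.Injective) : H →ₗᵢ[ℂ] H :=
    (b.orthonormal.comp f hf).orthogonalFamily.linearIsometry.comp b.repr.toLinearIsometry
  have hV (f : ι → ι) (hf : f.Injective) (x : H) :
      HasSum (fun i => b.repr x i • b (f i)) (V f hf x) := by
    simpa [V] using
      (b.orthonormal.comp f hf).orthogonalFamily.hasSum_linearIsometry (b.repr x)
  have hl : (fun i => e (.inl i)).Injective := e.injective.comp Sum.inl_injective
  have hr : (fun i => e (.inr i)).Injective := e.injective.comp Sum.inr_injective
  have horth (x y : H) : inner ℂ (V _ hl x) (V _ hr y) = 0 := by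
    refine ((hV _ hr y).mapL (innerSL ℂ (V _ hl x))).unique ?_
    convert hasSum_zero with i
    have h : inner ℂ (b (e (.inr i))) (V _ hl x) = 0 := by
      refine ((hV _ hl x).mapL (innerSL ℂ (b (e (.inr i))))).unique ?_
      convert hasSum_zero with j
      simp [b.orthonormal.2 (show e (.inr i) ≠ e (.inl j) by simp)]
    simp [inner_eq_zero_symm.1 h]
  refine closure_projections_eq_top_of_isometries
    (s := (V _ hl).toContinuousLinearMap) (t := (V _ hr).toContinuousLinearMap)
    (V _ hl).adjoint_comp_self (V _ hr).adjoint_comp_self ?_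
  ext y
  refine ext_inner_left ℂ fun x => ?_
  simp [ContinuousLinearMap.star_eq_adjoint, ContinuousLinearMap.adjoint_inner_right, horth]

end


/-- Bikchentaev's theorem: on a complex Hilbert space of dimension at least 2, the
subring of bounded operators generated by the orthogonal projections is the whole
ring of bounded operators. -/
theorem stmt_19 {H : Type*}
    [NormedAddCommGroup H] [InnerProductSpace ℂ H] [CompleteSpace H]
    (hdim : 2 ≤ Module.rank ℂ H) :
    Subring.closure {p : H →L[ℂ] H | IsSelfAdjoint p ∧ IsIdempotentElem p} = ⊤ := by
  obtain ⟨w, b, -⟩ := exists_hilbertBasis ℂ H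
  rcases finite_or_infinite w with _ | _
  · have := Fintype.ofFinite w
    have : Nontrivial w := by
      rw [← Cardinal.one_lt_iff_nontrivial]
      rw [rank_eq_card_basis b.toOrthonormalBasis.toBasis] at hdim
      rw [Cardinal.mk_fintype]
      exact lt_of_lt_of_le (by norm_num) hdim
    exact b.toOrthonormalBasis.closure_projections_eq_top
  · exact b.closure_projections_eq_top
end
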